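/- arXiv:2302.03899 — 2 statements merged into one kernel-verified Lean document; each statement's English description precedes it below -/
import Mathlib

section
/- Suppose the collection 𝒫_A^⊆ of potential-outcome distributions obeys distributional consistency. Let B and C be disjoint subsets of A (C possibly empty) and let Y = V∖B. Then for all y ∈ 𝔛_Y, b ∈ 𝔛_B, c ∈ 𝔛_C: p(X_Y(b,c) = y, X_B(b,c) = b) = p(X_Y(c) = y, X_B(c) = b), where (b,c) denotes the joint assignment to B ∪ C. -/
open Finset

namespace CausalPaper

variable {V : Type*} [Fintype V] [DecidableEq V]
variable {𝔛 : V → Type*} [∀ i, Fintype (𝔛 i)]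

/-- Probability of the event `E` under the distribution `q` on joint assignments. -/
noncomputable def pr (q : (∀ i, 𝔛 i) → ℝ) (E : (∀ i, 𝔛 i) → Prop) : ℝ :=
  ∑ v : (∀ i, 𝔛 i), Set.indicator (setOf E) q v

/-- Conditional probability of `E` given `F` under `q`. -/
noncomputable def cpr (q : (∀ i, 𝔛 i) → ℝ) (E F : (∀ i, 𝔛 i) → Prop) : ℝ :=
  pr q (fun v => E v ∧ F v) / pr q F

/-- `q` is a probability distribution on joint assignments. -/
def IsProb (q : (∀ i, 𝔛 i) → ℝ) : Prop :=
  (∀ v, 0 ≤ q v) ∧ (∑ v : (∀ i, 𝔛 i), q v) = 1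

/-- `v` agrees with `s` on the coordinates in `S`. -/
def agree (S : Finset V) (s v : ∀ i, 𝔛 i) : Prop :=
  ∀ i ∈ S, v i = s i

/-- The intervention/regime that sets the variables in `B` according to `b`
(and is idle elsewhere). -/
def setOn (B : Finset V) (b : ∀ i, 𝔛 i) : ∀ i, Option (𝔛 i) :=
  fun i => if i ∈ B then some (b i) else none

/-- The intervention/regime that sets `B` according to `b` and `C` according to `c`. -/
def setOn₂ (B : Finset V) (b : ∀ i, 𝔛 i) (C : Finset V) (c : ∀ i, 𝔛 i) :
    ∀ i, Option (𝔛 i) :=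
  fun i => if i ∈ B then some (b i) else if i ∈ C then some (c i) else none

/-- The support of the partial intervention/regime `f` is contained in `A`. -/
def suppIn (f : ∀ i, Option (𝔛 i)) (A : Finset V) : Prop :=
  ∀ i, f i ≠ none → i ∈ A

/-- Distributional consistency: for `i ∈ A`, `C ⊆ A \ {i}`, the probability of the
event `{X_{V∖{i}} = y, X_i = b}` is the same whether or not `i` is additionally
intervened on and set to `b`. -/
def DistConsistent (A : Finset V) (P : (∀ i, Option (𝔛 i)) → (∀ i, 𝔛 i) → ℝ) : Prop :=
  ∀ i ∈ A, ∀ C : Finset V, C ⊆ A \ {i} →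
    ∀ (y : ∀ j, 𝔛 j) (b : 𝔛 i) (c : ∀ j, 𝔛 j),
      pr (P (Function.update (setOn C c) i (some b)))
          (fun v => agree (univ \ {i}) y v ∧ v i = b)
        = pr (P (setOn C c)) (fun v => agree (univ \ {i}) y v ∧ v i = b)

omit [∀ i, Fintype (𝔛 i)] in
/-- The conjunction of agreement off `B` with `y` and on `B` with `b` pins down `v`. -/
lemma agree_compl_and_agree_iff (B : Finset V) (y b v : ∀ i, 𝔛 i) :
    (agree (univ \ B) y v ∧ agree B b v) ↔ v = B.piecewise b y := by
  constructor
  · rintro ⟨hy, hb⟩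
    funext j
    by_cases hj : j ∈ B
    · simpa [hj] using hb j hj
    · simpa [hj] using hy j (by simp [hj])
  · rintro rfl
    refine ⟨fun j hj => ?_, fun j hj => ?_⟩
    · exact Finset.piecewise_eq_of_notMem _ _ _ (mem_sdiff.mp hj).2
    · exact Finset.piecewise_eq_of_mem _ _ _ hj

omit [Fintype V] [∀ i, Fintype (𝔛 i)] in
lemma setOn₂_eq_setOn_union (B C : Finset V) (b c : ∀ i, 𝔛 i) :
    setOn₂ B b C c = setOn (B ∪ C) (B.piecewise b c) := by
  funext j
  by_cases hB : j ∈ B <;> by_cases hC : j ∈ C <;> simp [setOn₂, setOn, hB, hC]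

omit [Fintype V] [∀ i, Fintype (𝔛 i)] in
lemma setOn₂_insert (i : V) (B C : Finset V) (b c : ∀ i, 𝔛 i) :
    setOn₂ (insert i B) b C c = Function.update (setOn₂ B b C c) i (some (b i)) := by
  funext j
  by_cases hj : j = i
  · subst hj
    simp [setOn₂]
  · simp [setOn₂, hj]

/-- Distributional consistency, phrased for the probability of a single joint assignment. -/
lemma DistConsistent.pr_update_eq {A : Finset V}
    {P : (∀ i, Option (𝔛 i)) → (∀ i, 𝔛 i) → ℝ} (hDC : DistConsistent A P)
    {i : V} (hi : i ∈ A) {C : Finset V} (hC : C ⊆ A \ {i}) (w c : ∀ j, 𝔛 j) :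
    pr (P (Function.update (setOn C c) i (some (w i)))) (fun v => v = w)
      = pr (P (setOn C c)) (fun v => v = w) := by
  have hE : (fun v : ∀ j, 𝔛 j => agree (univ \ {i}) w v ∧ v i = w i) = fun v => v = w := by
    funext v
    simpa [agree, piecewise_same] using agree_compl_and_agree_iff {i} w w v
  simpa only [hE] using hDC i hi C hC w (w i) c

/-- Intervening on `B` according to `w` does not change the probability of `w`. -/
lemma DistConsistent.pr_setOn₂_eq {A : Finset V}
    {P : (∀ i, Option (𝔛 i)) → (∀ i, 𝔛 i) → ℝ} (hDC : DistConsistent A P)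
    {B C : Finset V} (hBA : B ⊆ A) (hCA : C ⊆ A) (hBC : Disjoint B C) (w c : ∀ j, 𝔛 j) :
    pr (P (setOn₂ B w C c)) (fun v => v = w) = pr (P (setOn C c)) (fun v => v = w) := by
  induction B using Finset.induction_on with
  | empty => simp [setOn₂_eq_setOn_union]
  | insert i B hiB ih =>
    rw [insert_subset_iff] at hBA
    rw [disjoint_insert_left] at hBC
    have hC : B ∪ C ⊆ A \ {i} :=
      subset_sdiff.mpr ⟨union_subset hBA.2 hCA, by simp [hiB, hBC.1]⟩
    rw [← ih hBA.2 hBC.2, setOn₂_insert, setOn₂_eq_setOn_union]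
    exact hDC.pr_update_eq hBA.1 hC w _

/-- Lemma 1 (distributional consistency for a set `B`): intervening on `B ∪ C`
with `B` set to `b` gives the same probability to the event `{X_{V∖B} = y, X_B = b}`
as intervening on `C` alone. -/
theorem stmt0_dist_consistency_vector
    (A B C : Finset V) (hBA : B ⊆ A) (hCA : C ⊆ A) (hBC : Disjoint B C)
    (P : (∀ i, Option (𝔛 i)) → (∀ i, 𝔛 i) → ℝ)
    (hP : ∀ f, suppIn f A → IsProb (P f))
    (hDC : DistConsistent A P)
    (y b c : ∀ j, 𝔛 j) :
    pr (P (setOn₂ B b C c)) (fun v => agree (univ \ B) y v ∧ agree B b v)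
      = pr (P (setOn C c)) (fun v => agree (univ \ B) y v ∧ agree B b v) := by
  have hw : setOn₂ B b C c = setOn₂ B (B.piecewise b y) C c := by
    funext j
    by_cases hj : j ∈ B <;> simp [setOn₂, hj]
  simp only [agree_compl_and_agree_iff, hw]
  exact hDC.pr_setOn₂_eq hBA hCA hBC _ c

end CausalPaper
end

section
/- Suppose the collection 𝒫_A^⊆ of potential-outcome distributions obeys distributional consistency. Let B and C be disjoint subsets of A (C possibly empty), and let Y, W be disjoint subsets of V with B ⊆ W. If the conditional distribution p(X_Y(b,c) = y | X_W(b,c) = w) does not depend on b (i.e., it agrees for all b, b′ ∈ 𝔛_B whenever the conditioning events have positive probability), then for all b, c, y and all w ∈ 𝔛_W such that p(X_W(b,c) = w) > 0 and p(X_W(c) = w) > 0: p(X_Y(b,c) = y | X_W(b,c) = w) = p(X_Y(c) = y | X_W(c) = w). -/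
open Finset

namespace CausalPaper

variable {V : Type*} [Fintype V] [DecidableEq V]
variable {𝔛 : V → Type*} [∀ i, Fintype (𝔛 i)]

/-- The probability of the event that pins down every coordinate is a point mass. -/
lemma pr_agree_compl_singleton (q : (∀ i, 𝔛 i) → ℝ) (i : V) (v : ∀ j, 𝔛 j) :
    pr q (fun u => agree (univ \ {i}) v u ∧ u i = v i) = q v := by
  have h : setOf (fun u => agree (univ \ {i}) v u ∧ u i = v i) = {v} := by
    ext u
    rw [Set.mem_singleton_iff]
    constructor
    · rintro ⟨h₁, h₂⟩
      funext j
      by_cases hj : j = i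
      · subst hj
        exact h₂
      · exact h₁ j (by simp [hj])
    · rintro rfl
      exact ⟨fun _ _ => rfl, rfl⟩
  rw [pr, h, Finset.sum_eq_single v]
  · simp
  · intro u _ hu
    simp [hu]
  · simp

/-- Two distributions that agree pointwise on an event assign it the same probability. -/
lemma pr_congr {q r : (∀ i, 𝔛 i) → ℝ} {E : (∀ i, 𝔛 i) → Prop}
    (h : ∀ v, E v → q v = r v) : pr q E = pr r E :=
  Finset.sum_congr rfl fun v _ => congrFun (Set.indicator_congr h) v

/-- Distributional consistency for a set `B` of targets: additionally intervening on `B` does not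
change the probability of an assignment that already has the intervened values on `B`. -/
lemma DistConsistent.setOn₂_apply {A : Finset V}
    {P : (∀ i, Option (𝔛 i)) → (∀ i, 𝔛 i) → ℝ} (hDC : DistConsistent A P)
    {B C : Finset V} (hBA : B ⊆ A) (hCA : C ⊆ A) (hBC : Disjoint B C)
    (b c v : ∀ i, 𝔛 i) (hv : agree B b v) :
    P (setOn₂ B b C c) v = P (setOn C c) v := by
  induction B using Finset.induction_on with
  | empty =>
    congr 1
  | insert i B hi ih =>
    rw [Finset.insert_subset_iff] at hBA
    rw [Finset.disjoint_insert_left] at hBC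
    rw [← ih hBA.2 hBC.2 fun j hj => hv j (Finset.mem_insert_of_mem hj)]
    have h₁ : setOn₂ B b C c = setOn (B ∪ C) (fun j => if j ∈ B then b j else c j) := by
      funext j
      by_cases hB : j ∈ B <;> simp [setOn₂, setOn, hB]
    have h₂ : setOn₂ (insert i B) b C c
        = Function.update (setOn (B ∪ C) (fun j => if j ∈ B then b j else c j)) i
            (some (v i)) := by
      rw [← h₁]
      funext j
      by_cases hj : j = i
      · subst hj
        simp [setOn₂, hv j (Finset.mem_insert_self _ _)]
      · simp [setOn₂, hj]
    have hsub : B ∪ C ⊆ A \ {i} := by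
      intro j hj
      rw [Finset.mem_sdiff, Finset.mem_singleton]
      refine ⟨Finset.union_subset hBA.2 hCA hj, ?_⟩
      rintro rfl
      exact (Finset.mem_union.mp hj).elim hi hBC.1
    have h := hDC i hBA.1 (B ∪ C) hsub v (v i) (fun j => if j ∈ B then b j else c j)
    rwa [pr_agree_compl_singleton, pr_agree_compl_singleton, ← h₂, ← h₁] at h

/-- Lemma 4: if the conditional distribution of `X_Y` given `X_W` under intervention
on `B ∪ C` does not depend on `b` (where `B ⊆ W`), then it equals the conditional
under intervening on `C` alone, whenever both conditioning events are positive. -/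
theorem stmt3_remove_b_from_conditional
    (A B C : Finset V) (hBA : B ⊆ A) (hCA : C ⊆ A) (hBC : Disjoint B C)
    (Y W : Finset V) (hYW : Disjoint Y W) (hBW : B ⊆ W)
    (P : (∀ i, Option (𝔛 i)) → (∀ i, 𝔛 i) → ℝ)
    (hP : ∀ f, suppIn f A → IsProb (P f))
    (hDC : DistConsistent A P)
    (hIndep : ∀ (b b' c w y : ∀ j, 𝔛 j),
      0 < pr (P (setOn₂ B b C c)) (agree W w) →
      0 < pr (P (setOn₂ B b' C c)) (agree W w) →
      cpr (P (setOn₂ B b C c)) (agree Y y) (agree W w)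
        = cpr (P (setOn₂ B b' C c)) (agree Y y) (agree W w)) :
    ∀ (b c y w : ∀ j, 𝔛 j),
      0 < pr (P (setOn₂ B b C c)) (agree W w) →
      0 < pr (P (setOn C c)) (agree W w) →
      cpr (P (setOn₂ B b C c)) (agree Y y) (agree W w)
        = cpr (P (setOn C c)) (agree Y y) (agree W w) := by
  intro b c y w hb hc
  have key : ∀ v, agree W w v → P (setOn₂ B w C c) v = P (setOn C c) v := fun v hv =>
    hDC.setOn₂_apply hBA hCA hBC w c v fun i hi => hv i (hBW hi)
  have hW : pr (P (setOn₂ B w C c)) (agree W w) = pr (P (setOn C c)) (agree W w) :=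
    pr_congr key
  rw [hIndep b w c w y hb (hW ▸ hc), cpr, cpr, hW, pr_congr fun v hv => key v hv.2]

end CausalPaper
end
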